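/- arXiv:2410.23941 — 4 statements merged into one kernel-verified Lean document; each statement's English description precedes it below -/
import Mathlib

section
/- Let C be a symmetric monoidal additive category with all small coproducts in which the tensor product commutes with coproducts in each variable, and suppose A is an object of C such that Loc⊗({A}) = C. Then for any localising tensor ideal L of C and any object X of C, one has X ∈ L if and only if X ⊗ A ∈ L. -/
open CategoryTheory CategoryTheory.Limits MonoidalCategory

universe v u u₂

/-- A localising tensor ideal: a class of objects closed under isomorphisms, direct
summands (retracts), small coproducts, and tensoring with arbitrary objects. -/
def IsLocalisingTensorIdeal (C : Type u) [Category.{v} C] [Preadditive C]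
    [MonoidalCategory C] [HasCoproducts.{v} C] (L : Set C) : Prop :=
  (∀ ⦃X Y : C⦄, (X ≅ Y) → X ∈ L → Y ∈ L) ∧
  (∀ ⦃X Y : C⦄ (i : X ⟶ Y) (r : Y ⟶ X), i ≫ r = 𝟙 X → Y ∈ L → X ∈ L) ∧
  (∀ ⦃ι : Type v⦄ (f : ι → C), (∀ j, f j ∈ L) → (∐ f) ∈ L) ∧
  (∀ ⦃X : C⦄, X ∈ L → ∀ Y : C, (X ⊗ Y) ∈ L)

/-- `Loc⊗(S)`: the smallest localising tensor ideal containing `S`. -/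
def locTensorIdealGen (C : Type u) [Category.{v} C] [Preadditive C]
    [MonoidalCategory C] [HasCoproducts.{v} C] (S : Set C) : Set C :=
  ⋂₀ {L : Set C | IsLocalisingTensorIdeal C L ∧ S ⊆ L}

/-- The objects whose tensor product with a fixed object `X` lies in a localising tensor ideal
form a localising tensor ideal. -/
theorem IsLocalisingTensorIdeal.preimage_tensorLeft {C : Type u} [Category.{v} C]
    [Preadditive C] [MonoidalCategory C] [HasCoproducts.{v} C] {L : Set C}
    (hL : IsLocalisingTensorIdeal C L) (X : C)
    [∀ ι : Type v, PreservesColimitsOfShape (Discrete ι) (tensorLeft X)] :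
    IsLocalisingTensorIdeal C {Y : C | (X ⊗ Y) ∈ L} := by
  obtain ⟨hiso, hretract, hcoprod, htensor⟩ := hL
  refine ⟨fun Y Z e hY => hiso (whiskerLeftIso X e) hY, fun Y Z i r hir hZ => ?_,
    fun ι f hf => ?_, fun Y hY Z => hiso (α_ X Y Z) (htensor hY Z)⟩
  · refine hretract (X ◁ i) (X ◁ r) ?_ hZ
    rw [← MonoidalCategory.whiskerLeft_comp, hir, MonoidalCategory.whiskerLeft_id]
  · exact hiso (PreservesCoproduct.iso (tensorLeft X) f).symm (hcoprod _ hf)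

/-- If `Loc⊗({A}) = C`, then for any localising tensor ideal `L` and any
object `X`, `X ∈ L` iff `X ⊗ A ∈ L`. -/
theorem statement5 {C : Type u} [Category.{v} C] [Preadditive C] [MonoidalCategory C]
    [SymmetricCategory C] [HasCoproducts.{v} C]
    [∀ (X : C) (ι : Type v), PreservesColimitsOfShape (Discrete ι) (tensorLeft X)]
    [∀ (X : C) (ι : Type v), PreservesColimitsOfShape (Discrete ι) (tensorRight X)]
    (A : C) (hA : locTensorIdealGen C {A} = Set.univ)
    (L : Set C) (hL : IsLocalisingTensorIdeal C L) (X : C) :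
    X ∈ L ↔ (X ⊗ A) ∈ L := by
  refine ⟨fun hX => hL.2.2.2 hX A, fun hXA => ?_⟩
  have hunit : 𝟙_ C ∈ locTensorIdealGen C {A} := hA ▸ Set.mem_univ _
  exact hL.1 (ρ_ X) (hunit {Y : C | (X ⊗ Y) ∈ L}
    ⟨hL.preimage_tensorLeft X, Set.singleton_subset_iff.mpr hXA⟩)
end

section
/- For every localising tensor ideal L of D, one has f_!⁻¹(L) = Loc⊗({f^*X : X ∈ L}); that is, the full subcategory of objects Y of C with f_!Y ∈ L coincides with the smallest localising tensor ideal of C containing all restrictions f^*X of objects X of L. -/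
open CategoryTheory CategoryTheory.Limits MonoidalCategory

universe v u u₂

/-- The preimage of a localising tensor ideal under a left adjoint satisfying the projection
formula and the retract property is a localising tensor ideal. -/
theorem IsLocalisingTensorIdeal.preimage_leftAdjoint
    {C : Type u} {D : Type u₂} [Category.{v} C] [Category.{v} D]
    [Preadditive C] [Preadditive D] [MonoidalCategory C] [MonoidalCategory D]
    [HasCoproducts.{v} C] [HasCoproducts.{v} D]
    {fStar : D ⥤ C} {fShriek : C ⥤ D} (adj : fShriek ⊣ fStar)
    (proj : ∀ (X : D) (Y : C),
      Nonempty (fShriek.obj (fStar.obj X ⊗ Y) ≅ X ⊗ fShriek.obj Y))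
    (retr : ∀ Y : C, ∃ (i : Y ⟶ fStar.obj (fShriek.obj Y))
      (r : fStar.obj (fShriek.obj Y) ⟶ Y), i ≫ r = 𝟙 Y)
    {L : Set D} (hL : IsLocalisingTensorIdeal D L) :
    IsLocalisingTensorIdeal C {Y : C | fShriek.obj Y ∈ L} := by
  obtain ⟨hiso, hretract, hcoprod, htensor⟩ := hL
  have : PreservesColimitsOfSize.{v, v} fShriek := adj.leftAdjoint_preservesColimits
  refine ⟨fun X Y e hX => hiso (fShriek.mapIso e) hX, fun X Y i r h hY => ?_,
    fun ι f hf => ?_, fun Y hY Z => ?_⟩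
  · exact hretract (fShriek.map i) (fShriek.map r) (by rw [← fShriek.map_comp, h, fShriek.map_id])
      hY
  · exact hiso (PreservesCoproduct.iso fShriek f).symm (hcoprod _ hf)
  · obtain ⟨i, r, h⟩ := retr Y
    obtain ⟨e⟩ := proj (fShriek.obj Y) Z
    refine hretract (fShriek.map (i ▷ Z)) (fShriek.map (r ▷ Z)) ?_
      (hiso e.symm (htensor hY (fShriek.obj Z)))
    rw [← fShriek.map_comp, ← comp_whiskerRight, h, id_whiskerRight, fShriek.map_id]

variable {C : Type u} {D : Type u₂} [Category.{v} C] [Category.{v} D]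
  [Preadditive C] [Preadditive D] [MonoidalCategory C] [MonoidalCategory D]
  [SymmetricCategory C] [SymmetricCategory D]
  [HasCoproducts.{v} C] [HasCoproducts.{v} D]
  [∀ (X : C) (ι : Type v), PreservesColimitsOfShape (Discrete ι) (tensorLeft X)]
  [∀ (X : C) (ι : Type v), PreservesColimitsOfShape (Discrete ι) (tensorRight X)]
  [∀ (X : D) (ι : Type v), PreservesColimitsOfShape (Discrete ι) (tensorLeft X)]
  [∀ (X : D) (ι : Type v), PreservesColimitsOfShape (Discrete ι) (tensorRight X)]

/-- `f_!⁻¹(L) = Loc⊗(f^*(L))`. -/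
theorem statement7
    (fStar : D ⥤ C) [fStar.Braided]
    [∀ ι : Type v, PreservesColimitsOfShape (Discrete ι) fStar]
    (fShriek : C ⥤ D) (adj : fShriek ⊣ fStar)
    (proj : ∀ (X : D) (Y : C),
      Nonempty (fShriek.obj (fStar.obj X ⊗ Y) ≅ X ⊗ fShriek.obj Y))
    (retr : ∀ Y : C, ∃ (i : Y ⟶ fStar.obj (fShriek.obj Y))
      (r : fStar.obj (fShriek.obj Y) ⟶ Y), i ≫ r = 𝟙 Y)
    (L : Set D) (hL : IsLocalisingTensorIdeal D L) :
    {Y : C | fShriek.obj Y ∈ L} = locTensorIdealGen C (fStar.obj '' L) := by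
  apply Set.Subset.antisymm
  · rintro Y hY I ⟨hI, hLI⟩
    obtain ⟨i, r, h⟩ := retr Y
    exact hI.2.1 i r h (hLI ⟨_, hY, rfl⟩)
  · refine Set.sInter_subset_of_mem ⟨hL.preimage_leftAdjoint adj proj retr, ?_⟩
    rintro _ ⟨X, hX, rfl⟩
    obtain ⟨e⟩ := proj X (𝟙_ C)
    exact hL.1 (e.symm ≪≫ fShriek.mapIso (ρ_ (fStar.obj X))) (hL.2.2.2 hX _)
end

section
/- If X is an object of D and Y an object of C such that f^*X ∈ Loc⊗({Y}), then f_!(f^*X) ∈ Loc⊗({f_!Y}). -/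
open CategoryTheory CategoryTheory.Limits MonoidalCategory

universe v u u₂

section

variable {C : Type u} [Category.{v} C] [Preadditive C] [MonoidalCategory C]
  [HasCoproducts.{v} C]

theorem isLocalisingTensorIdeal_locTensorIdealGen (S : Set C) :
    IsLocalisingTensorIdeal C (locTensorIdealGen C S) :=
  ⟨fun _ _ e hX L hL => hL.1.1 e (hX L hL),
    fun _ _ i r hir hY L hL => hL.1.2.1 i r hir (hY L hL),
    fun _ f hf L hL => hL.1.2.2.1 f fun j => hf j L hL,
    fun _ hX Y L hL => hL.1.2.2.2 (hX L hL) Y⟩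

theorem subset_locTensorIdealGen (S : Set C) : S ⊆ locTensorIdealGen C S :=
  fun _ hX _ hL => hL.2 hX

theorem locTensorIdealGen_subset {S L : Set C} (hL : IsLocalisingTensorIdeal C L)
    (hS : S ⊆ L) : locTensorIdealGen C S ⊆ L :=
  fun _ hX => hX L ⟨hL, hS⟩

/-- If `F` preserves coproducts, the objects all of whose tensor multiples are sent by `F`
into a given localising tensor ideal form a localising tensor ideal. -/
theorem IsLocalisingTensorIdeal.setOf_forall_obj_tensor_mem
    [∀ (X : C) (ι : Type v), PreservesColimitsOfShape (Discrete ι) (tensorRight X)]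
    {D : Type u₂} [Category.{v} D] [Preadditive D] [MonoidalCategory D]
    [HasCoproducts.{v} D] (F : C ⥤ D)
    [∀ ι : Type v, PreservesColimitsOfShape (Discrete ι) F]
    {M : Set D} (hM : IsLocalisingTensorIdeal D M) :
    IsLocalisingTensorIdeal C {Z | ∀ W : C, F.obj (Z ⊗ W) ∈ M} := by
  obtain ⟨hiso, hretract, hcoprod, -⟩ := hM
  refine ⟨fun A B e hA W => hiso (F.mapIso (whiskerRightIso e W)) (hA W),
    fun A B i r hir hB W => hretract (F.map (i ▷ W)) (F.map (r ▷ W)) ?_ (hB W),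
    fun ι f hf W => ?_,
    fun A hA B W => hiso (F.mapIso (α_ A B W)).symm (hA (B ⊗ W))⟩
  · rw [← F.map_comp, ← comp_whiskerRight, hir, id_whiskerRight, F.map_id]
  · exact hiso (PreservesCoproduct.iso (tensorRight W ⋙ F) f).symm
      (hcoprod _ fun j => hf j W)

end

variable {C : Type u} {D : Type u₂} [Category.{v} C] [Category.{v} D]
  [Preadditive C] [Preadditive D] [MonoidalCategory C] [MonoidalCategory D]
  [SymmetricCategory C] [SymmetricCategory D]
  [HasCoproducts.{v} C] [HasCoproducts.{v} D]
  [∀ (X : C) (ι : Type v), PreservesColimitsOfShape (Discrete ι) (tensorLeft X)]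
  [∀ (X : C) (ι : Type v), PreservesColimitsOfShape (Discrete ι) (tensorRight X)]
  [∀ (X : D) (ι : Type v), PreservesColimitsOfShape (Discrete ι) (tensorLeft X)]
  [∀ (X : D) (ι : Type v), PreservesColimitsOfShape (Discrete ι) (tensorRight X)]

/-- if `f^*X ∈ Loc⊗({Y})` then `f_!f^*X ∈ Loc⊗({f_!Y})`. -/
theorem statement8
    (fStar : D ⥤ C) [fStar.Braided]
    [∀ ι : Type v, PreservesColimitsOfShape (Discrete ι) fStar]
    (fShriek : C ⥤ D) (adj : fShriek ⊣ fStar)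
    (proj : ∀ (X : D) (Y : C),
      Nonempty (fShriek.obj (fStar.obj X ⊗ Y) ≅ X ⊗ fShriek.obj Y))
    (retr : ∀ Y : C, ∃ (i : Y ⟶ fStar.obj (fShriek.obj Y))
      (r : fStar.obj (fShriek.obj Y) ⟶ Y), i ≫ r = 𝟙 Y)
    (X : D) (Y : C) (h : fStar.obj X ∈ locTensorIdealGen C {Y}) :
    fShriek.obj (fStar.obj X) ∈ locTensorIdealGen D {fShriek.obj Y} := by
  have hM := isLocalisingTensorIdeal_locTensorIdealGen {fShriek.obj Y}
  have : ∀ ι : Type v, PreservesColimitsOfShape (Discrete ι) fShriek := fun ι =>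
    have := adj.leftAdjoint_preservesColimits
    inferInstance
  have hY : ∀ W : C, fShriek.obj (Y ⊗ W) ∈ locTensorIdealGen D {fShriek.obj Y} := by
    intro W
    obtain ⟨i, r, hir⟩ := retr W
    obtain ⟨e⟩ := proj (fShriek.obj W) Y
    refine hM.2.1 (fShriek.map (Y ◁ i)) (fShriek.map (Y ◁ r)) ?_ ?_
    · rw [← fShriek.map_comp, ← MonoidalCategory.whiskerLeft_comp, hir,
        MonoidalCategory.whiskerLeft_id, fShriek.map_id]
    · exact hM.1 (fShriek.mapIso (β_ _ _) ≪≫ e ≪≫ β_ _ _).symm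
        (hM.2.2.2 (subset_locTensorIdealGen _ rfl) _)
  have hX := locTensorIdealGen_subset (hM.setOf_forall_obj_tensor_mem fShriek)
    (Set.singleton_subset_iff.2 hY) h
  exact hM.1 (fShriek.mapIso (ρ_ _)) (hX (𝟙_ C))
end

section
/- The map L ↦ f_!⁻¹(L) = {Y in C : f_!Y ∈ L} from localising tensor ideals of D to localising tensor ideals of C preserves arbitrary meets and arbitrary joins: for any family (L_j)_{j∈J} of localising tensor ideals of D, f_!⁻¹(⋂_j L_j) = ⋂_j f_!⁻¹(L_j), and f_!⁻¹ of the smallest localising tensor ideal containing ⋃_j L_j equals the smallest localising tensor ideal containing ⋃_j f_!⁻¹(L_j). In particular f_!⁻¹ is a frame homomorphism for the lattice structure in which meet is intersection and join of a family is the smallest localising tensor ideal containing the union. -/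
open CategoryTheory CategoryTheory.Limits MonoidalCategory

universe v u u₂

variable {C : Type u} {D : Type u₂} [Category.{v} C] [Category.{v} D]
  [Preadditive C] [Preadditive D] [MonoidalCategory C] [MonoidalCategory D]
  [SymmetricCategory C] [SymmetricCategory D]
  [HasCoproducts.{v} C] [HasCoproducts.{v} D]
  [∀ (X : C) (ι : Type v), PreservesColimitsOfShape (Discrete ι) (tensorLeft X)]
  [∀ (X : C) (ι : Type v), PreservesColimitsOfShape (Discrete ι) (tensorRight X)]
  [∀ (X : D) (ι : Type v), PreservesColimitsOfShape (Discrete ι) (tensorLeft X)]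
  [∀ (X : D) (ι : Type v), PreservesColimitsOfShape (Discrete ι) (tensorRight X)]

theorem subset_locTensorIdealGen_s12 {E : Type u} [Category.{v} E] [Preadditive E]
    [MonoidalCategory E] [HasCoproducts.{v} E] (S : Set E) : S ⊆ locTensorIdealGen E S :=
  fun _ hX _ hL => hL.2 hX

theorem locTensorIdealGen_subset_s12 {E : Type u} [Category.{v} E] [Preadditive E]
    [MonoidalCategory E] [HasCoproducts.{v} E] {S L : Set E}
    (hL : IsLocalisingTensorIdeal E L) (hS : S ⊆ L) : locTensorIdealGen E S ⊆ L :=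
  fun _ hX => hX L ⟨hL, hS⟩

theorem isLocalisingTensorIdeal_locTensorIdealGen_s12 {E : Type u} [Category.{v} E] [Preadditive E]
    [MonoidalCategory E] [HasCoproducts.{v} E] (S : Set E) :
    IsLocalisingTensorIdeal E (locTensorIdealGen E S) :=
  ⟨fun _ _ e hX L hL => hL.1.1 e (hX L hL),
    fun _ _ i r h hY L hL => hL.1.2.1 i r h (hY L hL),
    fun _ f hf L hL => hL.1.2.2.1 f fun j => hf j L hL,
    fun _ hX Y L hL => hL.1.2.2.2 (hX L hL) Y⟩

/-- The preimage of a localising tensor ideal under a coproduct-preserving functor is a localising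
tensor ideal as soon as it is closed under tensoring with arbitrary objects. -/
theorem IsLocalisingTensorIdeal.preimage {A : Type u} {B : Type u₂} [Category.{v} A]
    [Category.{v} B] [Preadditive A] [Preadditive B] [MonoidalCategory A] [MonoidalCategory B]
    [HasCoproducts.{v} A] [HasCoproducts.{v} B] (F : A ⥤ B)
    [∀ ι : Type v, PreservesColimitsOfShape (Discrete ι) F] {L : Set B}
    (hL : IsLocalisingTensorIdeal B L)
    (htensor : ∀ X : A, F.obj X ∈ L → ∀ Y : A, F.obj (X ⊗ Y) ∈ L) :
    IsLocalisingTensorIdeal A {X : A | F.obj X ∈ L} :=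
  ⟨fun _ _ e hX => hL.1 (F.mapIso e) hX,
    fun _ _ i r h hY => hL.2.1 (F.map i) (F.map r) (by rw [← F.map_comp, h, F.map_id]) hY,
    fun _ f hf => hL.1 (PreservesCoproduct.iso F f).symm (hL.2.2.1 _ hf),
    fun X hX Y => htensor X hX Y⟩

/-- `f_!⁻¹` preserves arbitrary meets and arbitrary joins of localising
tensor ideals (i.e. it is a frame homomorphism). -/
theorem statement12
    (fStar : D ⥤ C) [fStar.Braided]
    [∀ ι : Type v, PreservesColimitsOfShape (Discrete ι) fStar]
    (fShriek : C ⥤ D) (adj : fShriek ⊣ fStar)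
    (proj : ∀ (X : D) (Y : C),
      Nonempty (fShriek.obj (fStar.obj X ⊗ Y) ≅ X ⊗ fShriek.obj Y))
    (retr : ∀ Y : C, ∃ (i : Y ⟶ fStar.obj (fShriek.obj Y))
      (r : fStar.obj (fShriek.obj Y) ⟶ Y), i ≫ r = 𝟙 Y)
    {J : Type*} (Ls : J → Set D) (hLs : ∀ j, IsLocalisingTensorIdeal D (Ls j)) :
    ({Y : C | fShriek.obj Y ∈ ⋂ j, Ls j} = ⋂ j, {Y : C | fShriek.obj Y ∈ Ls j}) ∧
    ({Y : C | fShriek.obj Y ∈ locTensorIdealGen D (⋃ j, Ls j)} =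
      locTensorIdealGen C (⋃ j, {Y : C | fShriek.obj Y ∈ Ls j})) := by
  have hShriek : ∀ {L : Set D}, IsLocalisingTensorIdeal D L →
      IsLocalisingTensorIdeal C {Y : C | fShriek.obj Y ∈ L} := by
    intro L hL
    have : ∀ ι : Type v, PreservesColimitsOfShape (Discrete ι) fShriek := fun ι =>
      have := adj.leftAdjoint_preservesColimits
      inferInstance
    refine hL.preimage fShriek fun Y hY Z => ?_
    obtain ⟨i, r, hir⟩ := retr Z
    obtain ⟨e⟩ := proj (fShriek.obj Z) Y
    refine hL.2.1 (fShriek.map (Y ◁ i)) (fShriek.map (Y ◁ r)) ?_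
      (hL.1 ?_ (hL.2.2.2 hY (fShriek.obj Z)))
    · rw [← fShriek.map_comp, ← whiskerLeft_comp, hir, whiskerLeft_id, fShriek.map_id]
    · exact (β_ _ _) ≪≫ e.symm ≪≫ fShriek.mapIso (β_ _ _)
  refine ⟨by ext Y; simp, Set.Subset.antisymm ?_ ?_⟩
  · intro Y hY
    have hM := isLocalisingTensorIdeal_locTensorIdealGen_s12
      (⋃ j, {Y : C | fShriek.obj Y ∈ Ls j})
    have hN := hM.preimage fStar fun X hX Z =>
      hM.1 (Functor.Monoidal.μIso fStar X Z) (hM.2.2.2 hX (fStar.obj Z))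
    obtain ⟨i, r, hir⟩ := retr Y
    refine hM.2.1 i r hir (locTensorIdealGen_subset_s12 hN ?_ hY)
    refine Set.iUnion_subset fun j X hX => subset_locTensorIdealGen_s12 _ (Set.mem_iUnion.2 ⟨j, ?_⟩)
    obtain ⟨e⟩ := proj X (𝟙_ C)
    exact (hLs j).1 (e.symm ≪≫ fShriek.mapIso (ρ_ _)) ((hLs j).2.2.2 hX _)
  · refine locTensorIdealGen_subset_s12
      (hShriek (isLocalisingTensorIdeal_locTensorIdealGen_s12 _)) ?_
    exact Set.iUnion_subset fun j Y hY =>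
      subset_locTensorIdealGen_s12 _ (Set.mem_iUnion.2 ⟨j, hY⟩)
end
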